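/- (Main theorem, closed form of the adversarial loss.) Under the Gaussian linear-regression model, for every p ∈ [1, ∞] with dual exponent q, every ε ≥ 0 and every θ ∈ ℝᵐ, the adversarial loss satisfies L_{p,ε}(θ) = c₂·σ_θ² + (c₁·σ_θ + ε·‖θ‖_q)², where c₁ = √(2/π) and c₂ = 1 − c₁². -/

import Mathlib

open MeasureTheory ProbabilityTheory
open scoped Matrix ENNReal

/-- The `ℓ_p` norm of a vector in `ℝᵐ`, via Mathlib's `PiLp` norm. -/
noncomputable def lpNorm {m : ℕ} (p : ℝ≥0∞) (x : Fin m → ℝ) : ℝ :=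
  ‖(WithLp.equiv p (Fin m → ℝ)).symm x‖

/-- A random vector `X : Ω → ℝᵐ` has the centered multivariate Gaussian law `N(0, S)`
(with `S` positive semidefinite) iff every linear functional of it is a centered real
Gaussian with the corresponding variance. -/
def HasCenteredGaussianLaw {Ω : Type*} [MeasurableSpace Ω] (μ : Measure Ω) {m : ℕ}
    (X : Ω → Fin m → ℝ) (S : Matrix (Fin m) (Fin m) ℝ) : Prop :=
  ∀ a : Fin m → ℝ,
    Measure.map (fun ω => X ω ⬝ᵥ a) μ = gaussianReal 0 (a ⬝ᵥ S.mulVec a).toNNReal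
lemma lpNorm_top_eq {m : ℕ} (x : Fin m → ℝ) : lpNorm ∞ x = ⨆ i, |x i| := by
  simp [_root_.lpNorm, PiLp.norm_eq_ciSup]

lemma lpNorm_one_eq {m : ℕ} (x : Fin m → ℝ) : lpNorm 1 x = ∑ i, |x i| := by
  simp [_root_.lpNorm, PiLp.norm_eq_of_L1]

lemma lpNorm_eq_sum {m : ℕ} {p : ℝ≥0∞} (hp : 0 < p.toReal) (x : Fin m → ℝ) :
    lpNorm p x = (∑ i, |x i| ^ p.toReal) ^ (1 / p.toReal) := by
  simp [_root_.lpNorm, PiLp.norm_eq_sum hp]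

lemma lpNorm_smul {m : ℕ} {p : ℝ≥0∞} (hp : 1 ≤ p) (c : ℝ) (x : Fin m → ℝ) :
    lpNorm p (c • x) = |c| * lpNorm p x := by
  have := Fact.mk hp
  exact norm_smul c ((WithLp.equiv p (Fin m → ℝ)).symm x)

lemma lpNorm_nonneg' {m : ℕ} {p : ℝ≥0∞} (hp : 1 ≤ p) (x : Fin m → ℝ) : 0 ≤ lpNorm p x := by
  have := Fact.mk hp
  exact norm_nonneg ((WithLp.equiv p (Fin m → ℝ)).symm x)

lemma dotProduct_le_lpNorm_one_mul_lpNorm_top {m : ℕ} (x y : Fin m → ℝ) :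
    x ⬝ᵥ y ≤ lpNorm 1 x * lpNorm ∞ y := by
  rw [lpNorm_one_eq, lpNorm_top_eq, Finset.sum_mul]
  refine Finset.sum_le_sum fun i _ => (le_abs_self _).trans ?_
  rw [abs_mul]
  gcongr
  exact le_ciSup (f := fun i => |y i|) (Set.finite_range _).bddAbove i

lemma dotProduct_le_lpNorm_mul_lpNorm {m : ℕ} {p q : ℝ≥0∞} (hpq : p.HolderConjugate q)
    (x y : Fin m → ℝ) : x ⬝ᵥ y ≤ lpNorm p x * lpNorm q y := by
  by_cases hp : p = ∞
  · obtain rfl : q = 1 := by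
      subst hp; exact (ENNReal.HolderConjugate.eq_top_iff_eq_one ∞ q).1 rfl
    rw [hp, dotProduct_comm, mul_comm]
    exact dotProduct_le_lpNorm_one_mul_lpNorm_top y x
  by_cases hq : q = ∞
  · obtain rfl : p = 1 := by
      subst hq; exact (ENNReal.HolderConjugate.eq_top_iff_eq_one ∞ p).1 rfl
    rw [hq]
    exact dotProduct_le_lpNorm_one_mul_lpNorm_top x y
  have h := ENNReal.HolderConjugate.toReal_of_ne_top hp hq
  rw [lpNorm_eq_sum h.pos, lpNorm_eq_sum h.symm.pos]
  exact Real.inner_le_Lp_mul_Lq _ x y h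

lemma exists_lpNorm_le_one_dotProduct_eq {m : ℕ} (hm : 0 < m) {p q : ℝ≥0∞}
    (hpq : p.HolderConjugate q) (x : Fin m → ℝ) :
    ∃ d : Fin m → ℝ, lpNorm p d ≤ 1 ∧ d ⬝ᵥ x = lpNorm q x := by
  have : Nonempty (Fin m) := ⟨⟨0, hm⟩⟩
  have hsign (t : ℝ) : |(SignType.sign t : ℝ)| ≤ 1 := by
    rcases lt_trichotomy t 0 with h | h | h <;> simp [h]
  by_cases hp : p = ∞
  · obtain rfl : q = 1 := by
      subst hp; exact (ENNReal.HolderConjugate.eq_top_iff_eq_one ∞ q).1 rfl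
    refine ⟨fun i => SignType.sign (x i), ?_, ?_⟩
    · rw [hp, lpNorm_top_eq]
      exact ciSup_le fun i => hsign _
    · rw [lpNorm_one_eq]
      exact Finset.sum_congr rfl fun i _ => sign_mul_self _
  by_cases hq : q = ∞
  · obtain rfl : p = 1 := by
      subst hq; exact (ENNReal.HolderConjugate.eq_top_iff_eq_one ∞ p).1 rfl
    obtain ⟨i, hi⟩ := exists_eq_ciSup_of_finite (f := fun i => |x i|)
    refine ⟨Pi.single i (SignType.sign (x i)), ?_, ?_⟩
    · rw [lpNorm_one_eq, Finset.sum_eq_single i]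
      · simpa using hsign (x i)
      · intro j _ hj
        simp [hj]
      · simp
    · rw [hq, lpNorm_top_eq, ← hi, single_dotProduct, sign_mul_self]
  have h := ENNReal.HolderConjugate.toReal_of_ne_top hp hq
  obtain ⟨g, hg, hgx⟩ := (NNReal.isGreatest_Lp Finset.univ (fun i => Real.nnabs (x i)) h.symm).1
  refine ⟨fun i => SignType.sign (x i) * g i, ?_, ?_⟩
  · rw [lpNorm_eq_sum h.pos]
    refine Real.rpow_le_one (by positivity) ?_ (by have := h.pos; positivity)
    calc ∑ i, |(SignType.sign (x i) : ℝ) * g i| ^ p.toReal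
        ≤ ∑ i, (g i : ℝ) ^ p.toReal := by
          have := h.pos
          gcongr with i
          rw [abs_mul, NNReal.abs_eq]
          exact mul_le_of_le_one_left (g i).2 (hsign _)
      _ ≤ 1 := by exact_mod_cast hg
  · rw [lpNorm_eq_sum h.symm.pos]
    have h2 := congrArg NNReal.toReal hgx
    push_cast at h2
    have h3 : (∑ i, |x i| ^ q.toReal) ^ (1 / q.toReal) = ∑ i, |x i| * g i := by
      simpa using h2.symm
    rw [h3]
    refine Finset.sum_congr rfl fun i _ => ?_
    rw [mul_right_comm, sign_mul_self]

lemma sSup_sq_sub_dotProduct {m : ℕ} (hm : 0 < m) {p q : ℝ≥0∞} (hp : 1 ≤ p) (hq : 1 ≤ q)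
    (hpq : p.HolderConjugate q) {ε : ℝ} (hε : 0 ≤ ε) (x θ : Fin m → ℝ) (y : ℝ) :
    sSup {z : ℝ | ∃ δ : Fin m → ℝ, lpNorm p δ ≤ ε ∧ z = (y - (x + δ) ⬝ᵥ θ) ^ 2}
      = (|y - x ⬝ᵥ θ| + ε * lpNorm q θ) ^ 2 := by
  have hθ := lpNorm_nonneg' hq θ
  refine IsGreatest.csSup_eq ⟨?_, ?_⟩
  · obtain ⟨d, hd, hdθ⟩ := exists_lpNorm_le_one_dotProduct_eq hm hpq θ
    have key (s : ℝ) (hs : |s| = 1) : lpNorm p ((s * ε) • d) ≤ ε := by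
      rw [lpNorm_smul hp, abs_mul, hs, one_mul, abs_of_nonneg hε]
      exact mul_le_of_le_one_right hε hd
    rcases le_total 0 (y - x ⬝ᵥ θ) with h | h
    · refine ⟨((-1) * ε) • d, key _ (by simp), ?_⟩
      rw [abs_of_nonneg h, add_dotProduct, smul_dotProduct, hdθ, smul_eq_mul]
      ring
    · refine ⟨(1 * ε) • d, key _ (by simp), ?_⟩
      rw [abs_of_nonpos h, add_dotProduct, smul_dotProduct, hdθ, smul_eq_mul]
      ring
  · rintro _ ⟨δ, hδ, rfl⟩
    have h1 : δ ⬝ᵥ θ ≤ ε * lpNorm q θ :=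
      (dotProduct_le_lpNorm_mul_lpNorm hpq δ θ).trans (by gcongr)
    have h2 : -(δ ⬝ᵥ θ) ≤ ε * lpNorm q θ := by
      rw [← neg_dotProduct]
      refine (dotProduct_le_lpNorm_mul_lpNorm hpq (-δ) θ).trans ?_
      have : lpNorm p (-δ) = lpNorm p δ := by simpa using lpNorm_smul hp (-1) δ
      rw [this]
      gcongr
    rw [sq_le_sq, abs_of_nonneg (a := |_| + _) (by positivity), add_dotProduct, ← sub_sub]
    exact (abs_sub _ _).trans (by gcongr; exact abs_le'.2 ⟨h1, h2⟩)

lemma integral_abs_gaussianReal_zero {v : NNReal} (hv : v ≠ 0) :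
    ∫ x, |x| ∂gaussianReal 0 v = √(2 / Real.pi) * √v := by
  have hv' : (0 : ℝ) < v := by positivity
  rw [integral_gaussianReal_eq_integral_smul hv]
  have h1 : ∀ x : ℝ, gaussianPDFReal 0 v x • |x|
      = (fun t => (√(2 * Real.pi * v))⁻¹ * (t * Real.exp (-(2 * v : ℝ)⁻¹ * t ^ 2))) |x| := by
    intro x
    simp only [gaussianPDFReal_def, smul_eq_mul, sub_zero, sq_abs]
    rw [show -x ^ 2 / (2 * (v : ℝ)) = -(2 * v : ℝ)⁻¹ * x ^ 2 by field_simp]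
    ring
  have h2 := integral_rpow_mul_exp_neg_mul_rpow (p := 2) (q := 1) (b := (2 * v : ℝ)⁻¹)
    (by norm_num) (by norm_num) (by positivity)
  norm_num [Real.rpow_neg_one] at h2
  simp_rw [h1]
  rw [integral_comp_abs
    (f := fun t => (√(2 * Real.pi * v))⁻¹ * (t * Real.exp (-(2 * v : ℝ)⁻¹ * t ^ 2))),
    integral_const_mul]
  have h3 : ∫ x in Set.Ioi (0 : ℝ), x * Real.exp (-(2 * v : ℝ)⁻¹ * x ^ 2) = v := by
    convert h2 using 1
    · simp [mul_comm]
    · ring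
  rw [h3, ← Real.sqrt_mul (by positivity), ← Real.sqrt_inv]
  symm
  rw [Real.sqrt_eq_iff_mul_self_eq_of_pos (by positivity), ← sq, mul_pow, mul_pow,
    Real.sq_sqrt (by positivity)]
  field_simp

lemma integral_sq_abs_add_gaussianReal_zero {v : NNReal} (hv : v ≠ 0) (b : ℝ) :
    ∫ x, (|x| + b) ^ 2 ∂gaussianReal 0 v = v + 2 * b * (√(2 / Real.pi) * √v) + b ^ 2 := by
  have hL := memLp_id_gaussianReal (μ := 0) (v := v) 2
  have hsq : Integrable (fun x : ℝ => x ^ 2) (gaussianReal 0 v) := hL.integrable_sq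
  have habs : Integrable (fun x : ℝ => |x|) (gaussianReal 0 v) :=
    (hL.integrable (by norm_num)).abs
  have hvar : ∫ x, x ^ 2 ∂gaussianReal 0 v = v := by
    rw [← variance_fun_id_gaussianReal (μ := 0) (v := v),
      variance_of_integral_eq_zero (by fun_prop) integral_id_gaussianReal]
  calc ∫ x, (|x| + b) ^ 2 ∂gaussianReal 0 v
      = ∫ x, (x ^ 2 + 2 * b * |x| + b ^ 2) ∂gaussianReal 0 v := by
        congr with x
        rw [add_sq, sq_abs]
        ring
    _ = _ := by
        rw [integral_add (f := fun x => x ^ 2 + 2 * b * |x|) (hsq.add (habs.const_mul _))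
            (integrable_const _),
          integral_add hsq (habs.const_mul _), integral_const_mul, hvar,
          integral_abs_gaussianReal_zero hv]
        simp

/-- In the Gaussian linear-regression model, for every `p ∈ [1,∞]` with dual exponent `q`,
`ε ≥ 0` and `θ ∈ ℝᵐ`, the adversarial loss
`L_{p,ε}(θ) = E[sup_{‖δ‖_p ≤ ε} (Y − ⟨X + δ, θ⟩)²]` satisfies
`L_{p,ε}(θ) = c₂·σ_θ² + (c₁·σ_θ + ε·‖θ‖_q)²`, where `c₁ = √(2/π)`, `c₂ = 1 − c₁²` and
`σ_θ = sqrt((θ − θopt)ᵀ Σ (θ − θopt) + σ_w²)`. -/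
theorem adv_loss_closed_form {Ω : Type*} [MeasurableSpace Ω]
    (μ : Measure Ω) [IsProbabilityMeasure μ] {m : ℕ} (hm : 0 < m)
    (S : Matrix (Fin m) (Fin m) ℝ) (hS : S.PosSemidef)
    (θopt : Fin m → ℝ) (σw : ℝ) (hσw : 0 < σw)
    (X : Ω → Fin m → ℝ) (hXmeas : Measurable X)
    (W : Ω → ℝ) (hWmeas : Measurable W)
    (hX : HasCenteredGaussianLaw μ X S)
    (hW : Measure.map W μ = gaussianReal 0 ⟨σw ^ 2, sq_nonneg σw⟩)
    (hindep : IndepFun X W μ)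
    (Y : Ω → ℝ) (hY : ∀ ω, Y ω = X ω ⬝ᵥ θopt + W ω)
    (p q : ℝ≥0∞) (hp : 1 ≤ p) (hpq : 1 / p + 1 / q = 1)
    (ε : ℝ) (hε : 0 ≤ ε) (θ : Fin m → ℝ) :
    ∫ ω, sSup {z : ℝ | ∃ δ : Fin m → ℝ,
        lpNorm p δ ≤ ε ∧ z = (Y ω - (X ω + δ) ⬝ᵥ θ) ^ 2} ∂μ
      = (1 - Real.sqrt (2 / Real.pi) ^ 2)
            * Real.sqrt ((θ - θopt) ⬝ᵥ S.mulVec (θ - θopt) + σw ^ 2) ^ 2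
          + (Real.sqrt (2 / Real.pi)
                * Real.sqrt ((θ - θopt) ⬝ᵥ S.mulVec (θ - θopt) + σw ^ 2)
              + ε * lpNorm q θ) ^ 2 := by
  have hpq' : p.HolderConjugate q := by
    rw [ENNReal.holderConjugate_iff]
    simpa using hpq
  have hq : 1 ≤ q := ENNReal.HolderConjugate.one_le q p
  set A : ℝ := (θ - θopt) ⬝ᵥ S.mulVec (θ - θopt) with hA
  have hA0 : 0 ≤ A := hS.dotProduct_mulVec_nonneg (θ - θopt)
  obtain ⟨w, hw, hW'⟩ : ∃ w : NNReal, (w : ℝ) = σw ^ 2 ∧ μ.map W = gaussianReal 0 w :=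
    ⟨_, rfl, hW⟩
  set v : NNReal := A.toNNReal + w with hv
  have hvA : (v : ℝ) = A + σw ^ 2 := by
    rw [hv, NNReal.coe_add, Real.coe_toNNReal _ hA0, hw]
  have hv0 : v ≠ 0 := by
    rw [← NNReal.coe_ne_zero, hvA]
    positivity
  have hX' : μ.map (fun ω => X ω ⬝ᵥ (θopt - θ)) = gaussianReal 0 A.toNNReal := by
    rw [hX, hA, ← neg_sub θ θopt, Matrix.mulVec_neg, neg_dotProduct_neg]
  have hmeas : Measurable fun x : Fin m → ℝ => x ⬝ᵥ (θopt - θ) := by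
    unfold dotProduct
    fun_prop
  have hR : μ.map ((fun ω => X ω ⬝ᵥ (θopt - θ)) + W) = gaussianReal 0 v := by
    have := gaussianReal_add_gaussianReal_of_indepFun
      (hindep.comp hmeas measurable_id) hX' hW'
    rwa [add_zero] at this
  have hRmeas : Measurable ((fun ω => X ω ⬝ᵥ (θopt - θ)) + W) := (hmeas.comp hXmeas).add hWmeas
  calc _ = ∫ ω, (|((fun ω => X ω ⬝ᵥ (θopt - θ)) + W) ω| + ε * lpNorm q θ) ^ 2 ∂μ := by
        congr with ω
        rw [sSup_sq_sub_dotProduct hm hp hq hpq' hε, hY]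
        simp only [Pi.add_apply, dotProduct_sub]
        ring_nf
    _ = ∫ x, (|x| + ε * lpNorm q θ) ^ 2 ∂gaussianReal 0 v := by
        rw [← hR, integral_map hRmeas.aemeasurable (by fun_prop)]
    _ = _ := by
        rw [integral_sq_abs_add_gaussianReal_zero hv0, hvA]
        linear_combination
          -(Real.sq_sqrt (show 0 ≤ A + σw ^ 2 by positivity))
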